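/- Let (W,S) be a Coxeter system of rank 3 with S = {r,s,t}, in which rt = tr (the product rt has order 2), the order of st equals 3, and the order m_{sr} of sr satisfies m_{sr} ≥ 7 (possibly infinite). Then there is no element w of W admitting elements w₁, w₂ ∈ W with w = w₁·t·s, ℓ(w) = ℓ(w₁) + 2, and w = w₂·r, ℓ(w) = ℓ(w₂) + 1. -/

import Mathlib

open LaurentPolynomial

namespace CoxeterSystem

variable {B W : Type*} [Group W] {M : CoxeterMatrix B} (cs : CoxeterSystem M W)

/-- The generator `i` acting on pairs `(τ, ε)`: it conjugates `τ` by the simple reflection of `i`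
and flips the sign `ε` exactly when `τ` is that simple reflection. -/
noncomputable def signedConj (i : B) : Function.End (W × ZMod 2) :=
  open Classical in
  fun x ↦ (cs.simple i * x.1 * cs.simple i, x.2 + if x.1 = cs.simple i then 1 else 0)

open Classical in
theorem prod_map_signedConj_apply (ω : List B) (τ : W) (ε : ZMod 2) :
    (ω.map cs.signedConj).prod (τ, ε) =
      (cs.wordProd ω * τ * (cs.wordProd ω)⁻¹, ε + (cs.rightInvSeq ω).count τ) := by
  induction ω with
  | nil =>
    change (τ, ε) = _
    simp
  | cons i ω ih =>
    rw [List.map_cons, List.prod_cons]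
    change cs.signedConj i ((ω.map cs.signedConj).prod (τ, ε)) = _
    rw [ih]
    have key : cs.wordProd ω * τ * (cs.wordProd ω)⁻¹ = cs.simple i ↔
        (cs.wordProd ω)⁻¹ * cs.simple i * cs.wordProd ω = τ := by
      rw [mul_inv_eq_iff_eq_mul, mul_assoc, inv_mul_eq_iff_eq_mul, eq_comm]
    ext
    · simp [signedConj, wordProd_cons, mul_assoc]
    · simp only [signedConj, rightInvSeq, List.count_cons, beq_iff_eq, key]
      push_cast
      ring

theorem simple_mul_pow_mul_simple (i j : B) (k : ℕ) :
    cs.simple j * (cs.simple i * cs.simple j) ^ k * cs.simple j =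
      ((cs.simple i * cs.simple j) ^ k)⁻¹ := by
  have h := conj_pow (a := cs.simple j) (b := cs.simple i * cs.simple j) (i := k)
  rw [inv_simple] at h
  rw [← h, ← inv_pow]
  simp [mul_assoc]

open Classical in
theorem count_rightInvSeq_alternatingWord (i j : B) (n : ℕ) (τ : W) :
    (cs.rightInvSeq (alternatingWord i j (2 * n))).count τ =
      ∑ m ∈ Finset.range (2 * n),
        if cs.simple j * (cs.simple i * cs.simple j) ^ m = τ then 1 else 0 := by
  induction n with
  | zero => simp [alternatingWord]
  | succ n ih =>
    have hg : ((cs.simple i * cs.simple j) ^ n)⁻¹ * cs.simple j =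
        cs.simple j * (cs.simple i * cs.simple j) ^ n := by
      rw [← cs.simple_mul_pow_mul_simple, simple_mul_simple_cancel_right]
    rw [show 2 * (n + 1) = 2 * n + 1 + 1 by ring, Finset.sum_range_succ, Finset.sum_range_succ,
      ← ih, alternatingWord_succ', alternatingWord_succ']
    have hw : cs.wordProd (alternatingWord i j (2 * n)) = (cs.simple i * cs.simple j) ^ n := by
      simp [prod_alternatingWord_eq_mul_pow]
    have h1 : ((cs.simple i * cs.simple j) ^ n)⁻¹ * cs.simple j *
        (cs.simple i * cs.simple j) ^ n = cs.simple j * (cs.simple i * cs.simple j) ^ (2 * n) := by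
      rw [hg, mul_assoc, ← pow_add, two_mul]
    have h2 : (cs.simple j * (cs.simple i * cs.simple j) ^ n)⁻¹ * cs.simple i *
        (cs.simple j * (cs.simple i * cs.simple j) ^ n) =
          cs.simple j * (cs.simple i * cs.simple j) ^ (2 * n + 1) := by
      rw [mul_inv_rev, inv_simple, hg, mul_assoc, mul_assoc, ← mul_assoc (cs.simple i), ← pow_succ',
        ← pow_add]
      congr 2
      ring
    simp only [rightInvSeq, List.count_cons, wordProd_cons, hw, h1, h2, beq_iff_eq,
      Nat.not_even_bit1, even_two, Even.mul_right, if_true, if_false]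

theorem isLiftable_signedConj : M.IsLiftable cs.signedConj := by
  classical
  intro i j
  have hprod (n : ℕ) : (cs.signedConj i * cs.signedConj j) ^ n =
      ((alternatingWord i j (2 * n)).map cs.signedConj).prod := by
    induction n with
    | zero => simp [alternatingWord]
    | succ n ih =>
      rw [show 2 * (n + 1) = 2 * n + 1 + 1 by ring, alternatingWord_succ', alternatingWord_succ',
        pow_succ', ih]
      simp [mul_assoc]
  funext ⟨τ, ε⟩
  rw [hprod, prod_map_signedConj_apply, count_rightInvSeq_alternatingWord, two_mul,
    Finset.sum_range_add, ← two_mul]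
  simp only [pow_add, simple_mul_simple_pow, one_mul]
  change _ = (τ, ε)
  simp [prod_alternatingWord_eq_mul_pow, CharTwo.add_self_eq_zero]

open Classical in
theorem count_rightInvSeq_congr {ω ω' : List B} (h : cs.wordProd ω = cs.wordProd ω') (τ : W) :
    ((cs.rightInvSeq ω).count τ : ZMod 2) = (cs.rightInvSeq ω').count τ := by
  have key (υ : List B) : cs.lift ⟨_, cs.isLiftable_signedConj⟩ (cs.wordProd υ) =
      (υ.map cs.signedConj).prod := by
    rw [wordProd, map_list_prod, List.map_map]
    congr 2
    funext i
    simp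
  have h2 := congrArg Prod.snd (congrFun ((key ω).symm.trans ((congrArg _ h).trans (key ω')))
    (τ, (0 : ZMod 2)))
  simpa [prod_map_signedConj_apply] using h2

/-- The exchange condition, for words that need not be reduced. -/
theorem simple_mem_rightInvSeq {ω : List B} {i : B}
    (h : cs.IsRightDescent (cs.wordProd ω) i) : cs.simple i ∈ cs.rightInvSeq ω := by
  classical
  obtain ⟨υ, hυ, hυω⟩ := cs.exists_isReduced (cs.wordProd ω * cs.simple i)
  have hprod : cs.wordProd ω = cs.wordProd (υ.concat i) := by
    rw [wordProd_concat, ← hυω, simple_mul_simple_cancel_right]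
  have hred : cs.IsReduced (υ.concat i) := by
    rw [IsReduced, ← hprod, ← cs.isRightDescent_iff.1 h, hυω, hυ.eq]
    simp
  have hmem : cs.simple i ∈ cs.rightInvSeq (υ.concat i) := by
    rw [rightInvSeq_concat]
    simp
  have hcount := cs.count_rightInvSeq_congr hprod (cs.simple i)
  rw [List.count_eq_one_of_mem hred.nodup_rightInvSeq hmem] at hcount
  by_contra hnot
  rw [List.count_eq_zero_of_not_mem hnot] at hcount
  simp at hcount

theorem rightInvSeq_append (ω ω' : List B) :
    cs.rightInvSeq (ω ++ ω') =
      (cs.rightInvSeq ω).map (fun τ ↦ (cs.wordProd ω')⁻¹ * τ * cs.wordProd ω') ++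
        cs.rightInvSeq ω' := by
  induction ω with
  | nil => simp
  | cons i ω ih => simp [rightInvSeq, ih, wordProd_append, mul_assoc]

/-- The exchange condition relative to a shortest element `z` of a left coset of `H`. -/
theorem simple_mem_rightInvSeq_of_minimal {H : Subgroup W} {z : W}
    (hz : ∀ u ∈ H, cs.length z ≤ cs.length (z * u)) {ω : List B} {i : B}
    (hω : cs.wordProd ω ∈ H) (hi : cs.simple i ∈ H)
    (h : cs.IsRightDescent (z * cs.wordProd ω) i) : cs.simple i ∈ cs.rightInvSeq ω := by
  obtain ⟨ζ, hζ, rfl⟩ := cs.exists_isReduced z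
  rw [← wordProd_append] at h
  have hmem := cs.simple_mem_rightInvSeq h
  rw [rightInvSeq_append, List.mem_append, List.mem_map] at hmem
  refine hmem.resolve_left ?_
  rintro ⟨τ, hτ, hτi⟩
  have hτH : τ ∈ H := by
    have : τ = cs.wordProd ω * cs.simple i * (cs.wordProd ω)⁻¹ := by rw [← hτi]; group
    rw [this]
    exact H.mul_mem (H.mul_mem hω hi) (H.inv_mem hω)
  exact absurd (cs.isRightInversion_of_mem_rightInvSeq hζ hτ).2 (not_lt.2 (hz τ hτH))

/-- An element without right descents `i ∈ I` is shortest in its coset of the standard parabolic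
subgroup generated by `I`. -/
theorem length_le_length_mul_of_mem_closure {I : Set B} {q : W}
    (hq : ∀ i ∈ I, ¬ cs.IsRightDescent q i) {u : W}
    (hu : u ∈ Subgroup.closure (cs.simple '' I)) : cs.length q ≤ cs.length (q * u) := by
  set H := Subgroup.closure (cs.simple '' I)
  have hsimple {i : B} (hi : i ∈ I) : cs.simple i ∈ H := Subgroup.subset_closure ⟨i, hi, rfl⟩
  have hwordMem {ω : List B} (hω : ∀ i ∈ ω, i ∈ I) : cs.wordProd ω ∈ H := by
    refine H.list_prod_mem ?_
    simp only [List.mem_map, forall_exists_index, and_imp, forall_apply_eq_imp_iff₂]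
    exact fun i hi ↦ hsimple (hω i hi)
  have hword (v : W) (hv : v ∈ H) : ∃ ω : List B, (∀ i ∈ ω, i ∈ I) ∧ cs.wordProd ω = v := by
    induction hv using Subgroup.closure_induction with
    | mem x hx =>
      obtain ⟨i, hi, rfl⟩ := hx
      exact ⟨[i], by simpa using hi, by simp⟩
    | one => exact ⟨[], by simp, by simp⟩
    | mul x y _ _ hx hy =>
      obtain ⟨ω, hω, rfl⟩ := hx
      obtain ⟨υ, hυ, rfl⟩ := hy
      refine ⟨ω ++ υ, fun i hi ↦ ?_, cs.wordProd_append _ _⟩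
      exact (List.mem_append.1 hi).elim (hω i) (hυ i)
    | inv x _ hx =>
      obtain ⟨ω, hω, rfl⟩ := hx
      exact ⟨ω.reverse, fun i hi ↦ hω i (List.mem_reverse.1 hi), by simp⟩
  -- `v` makes `q * v` shortest in the coset, and `ω` is a shortest word in `I` for `v⁻¹`.
  obtain ⟨v, hv, hvmin⟩ : ∃ v ∈ H, ∀ u ∈ H, cs.length (q * v) ≤ cs.length (q * u) := by
    obtain ⟨v, hv, hmin⟩ := (measure fun u ↦ cs.length (q * u)).wf.has_min (H : Set W)
      ⟨1, H.one_mem⟩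
    exact ⟨v, hv, fun u hu ↦ not_lt.1 (hmin u hu)⟩
  obtain ⟨ω, ⟨hωI, hωv⟩, hωmin⟩ := (measure List.length).wf.has_min
    {ω : List B | (∀ i ∈ ω, i ∈ I) ∧ cs.wordProd ω = v⁻¹} (hword _ (H.inv_mem hv))
  have hz : ∀ u ∈ H, cs.length (q * v) ≤ cs.length (q * v * u) := fun u hu ↦ by
    rw [mul_assoc]
    exact hvmin _ (H.mul_mem hv hu)
  rcases List.eq_nil_or_concat ω with rfl | ⟨υ, i, rfl⟩
  · have hv1 : v = 1 := by simpa [eq_comm] using hωv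
    simpa [hv1] using hvmin u hu
  exfalso
  have hiI : i ∈ I := hωI i (by simp)
  have hυI : ∀ j ∈ υ, j ∈ I := fun j hj ↦ hωI j (by simp [hj])
  have hυq : q * v * cs.wordProd υ = q * cs.simple i := by
    rw [wordProd_concat] at hωv
    rw [← inv_eq_iff_eq_inv.2 hωv]
    simp [mul_assoc]
  have hdesc : cs.IsRightDescent (q * v * cs.wordProd υ) i := by
    have := cs.not_isRightDescent_iff.1 (hq i hiI)
    rw [hυq, IsRightDescent, simple_mul_simple_cancel_right]
    lia
  have hmem := cs.simple_mem_rightInvSeq_of_minimal hz (hwordMem hυI) (hsimple hiI) hdesc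
  obtain ⟨k, hk, hki⟩ := List.mem_iff_getElem.1 hmem
  have hk' : k < υ.length := by simpa using hk
  refine hωmin (υ.eraseIdx k) ⟨fun j hj ↦ hυI j (List.mem_of_mem_eraseIdx hj), ?_⟩ ?_
  · rw [← wordProd_mul_getD_rightInvSeq, List.getD_eq_getElem _ _ hk, hki, ← hωv, wordProd_concat]
  · change (υ.eraseIdx k).length < _
    rw [List.length_eraseIdx_of_lt hk']
    simp only [List.length_concat]
    lia

theorem exists_pow_of_mem_rightInvSeq_alternatingWord {i j : B} {k : ℕ} {τ : W}
    (hτ : τ ∈ cs.rightInvSeq (alternatingWord i j k)) :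
    ∃ l < k, τ = (cs.simple j * cs.simple i) ^ l * cs.simple j := by
  induction k generalizing i j τ with
  | zero => simp [alternatingWord] at hτ
  | succ k ih =>
    rw [alternatingWord_succ, rightInvSeq_concat, List.concat_eq_append, List.mem_append,
      List.mem_map, List.mem_singleton] at hτ
    rcases hτ with ⟨σ, hσ, rfl⟩ | rfl
    · obtain ⟨l, hl, rfl⟩ := ih hσ
      refine ⟨l + 1, by lia, ?_⟩
      have hcomm := mul_pow_mul (cs.simple j) (cs.simple i) l
      simp only [MulAut.conj_apply, inv_simple]
      rw [← mul_assoc, ← hcomm]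
      simp [pow_succ, mul_assoc]
    · exact ⟨0, by lia, by simp⟩

/-- If `i` and `j` are right descents of `p`, then stripping letters alternately `j, i, j, …` from
the right of `p` shortens it for as long as the order of `s j * s i` permits. -/
theorem length_mul_alternatingWord_inv {p : W} {i j : B} (hi : cs.IsRightDescent p i)
    (hj : cs.IsRightDescent p j) {k : ℕ}
    (hk : orderOf (cs.simple j * cs.simple i) = 0 ∨ k ≤ orderOf (cs.simple j * cs.simple i)) :
    cs.length (p * (cs.wordProd (alternatingWord i j k))⁻¹) + k = cs.length p := by
  induction k with
  | zero => simp [alternatingWord]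
  | succ k ih =>
    have ihk := ih (hk.imp id (by lia))
    set q := p * (cs.wordProd (alternatingWord i j k))⁻¹ with hq
    have hqp : q * cs.wordProd (alternatingWord i j k) = p := by simp [hq]
    rw [alternatingWord_succ', wordProd_cons, mul_inv_rev, inv_simple, ← mul_assoc, ← hq]
    by_contra hne
    have hup : ¬ cs.IsRightDescent q (if Even k then j else i) := by
      rw [isRightDescent_iff]
      lia
    rcases k with _ | k
    · exact hup (by simpa [hq, alternatingWord] using hj)
    have hprev : ¬ cs.IsRightDescent q (if Even k then j else i) := by
      have hstep : q * cs.simple (if Even k then j else i) *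
          cs.wordProd (alternatingWord i j k) = p := by
        rw [← hqp, alternatingWord_succ', wordProd_cons, mul_assoc]
      have h1 := cs.length_mul_le (q * cs.simple (if Even k then j else i))
        (cs.wordProd (alternatingWord i j k))
      have h2 := cs.length_wordProd_le (alternatingWord i j k)
      rw [hstep] at h1
      rw [length_alternatingWord] at h2
      rw [isRightDescent_iff]
      lia
    have hboth : ∀ x ∈ ({i, j} : Set B), ¬ cs.IsRightDescent q x := by
      rintro x (rfl | rfl) <;> by_cases hev : Even k <;>
        simp_all [Nat.even_add_one]
    have hH {x : B} (hx : x ∈ ({i, j} : Set B)) :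
        cs.simple x ∈ Subgroup.closure (cs.simple '' {i, j}) :=
      Subgroup.subset_closure ⟨x, hx, rfl⟩
    have hword : cs.wordProd (alternatingWord i j (k + 1)) ∈
        Subgroup.closure (cs.simple '' {i, j}) := by
      rw [prod_alternatingWord_eq_mul_pow]
      refine mul_mem ?_ (pow_mem (mul_mem (hH (by simp)) (hH (by simp))) _)
      split_ifs
      exacts [one_mem _, hH (by simp)]
    have hmem := cs.simple_mem_rightInvSeq_of_minimal
      (fun u hu ↦ cs.length_le_length_mul_of_mem_closure hboth hu) hword (hH (by simp))
      (hqp.symm ▸ hi)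
    obtain ⟨l, hl, hli⟩ := cs.exists_pow_of_mem_rightInvSeq_alternatingWord hmem
    have hpow : (cs.simple j * cs.simple i) ^ (l + 1) = 1 := by
      rw [pow_succ, ← mul_assoc, ← hli, simple_mul_simple_self]
    have hdvd := orderOf_dvd_of_pow_eq_one hpow
    rcases hk with h0 | hk
    · rw [h0, zero_dvd_iff] at hdvd
      lia
    · have := Nat.le_of_dvd (by lia) hdvd
      lia

theorem isRightDescent_mul_of_commute
    {a b : B} (hab : orderOf (cs.simple a * cs.simple b) = 2) {x : W}
    (ha : cs.IsRightDescent x a) (hb : cs.IsRightDescent x b) :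
    cs.IsRightDescent (x * cs.simple a) b := by
  have h := cs.length_mul_alternatingWord_inv hb ha (k := 2) (.inr hab.ge)
  simp only [alternatingWord, List.concat_eq_append, List.nil_append, List.cons_append,
    wordProd_cons, wordProd_nil, mul_one, mul_inv_rev, inv_simple, ← mul_assoc] at h
  rw [isRightDescent_iff] at *
  lia

theorem isRightDescent_mul_of_braid
    {a b : B} (hab : orderOf (cs.simple a * cs.simple b) = 3) {x : W}
    (ha : cs.IsRightDescent x a) (hb : cs.IsRightDescent x b) :
    cs.IsRightDescent (x * cs.simple a) b ∧
      cs.IsRightDescent (x * cs.simple a * cs.simple b) a := by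
  have h := cs.length_mul_alternatingWord_inv hb ha (k := 3) (.inr hab.ge)
  simp only [alternatingWord, List.concat_eq_append, List.nil_append, List.cons_append,
    wordProd_cons, wordProd_nil, mul_one, mul_inv_rev, inv_simple, ← mul_assoc] at h
  have h2 := cs.length_mul_simple (x * cs.simple a) b
  have h3 := cs.length_mul_simple (x * cs.simple a * cs.simple b) a
  rw [isRightDescent_iff] at *
  rw [isRightDescent_iff]
  lia

theorem isRightDescent_mul_of_le_orderOf
    {a b : B} (hab : orderOf (cs.simple a * cs.simple b) = 0 ∨
      6 ≤ orderOf (cs.simple a * cs.simple b)) {x : W}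
    (ha : cs.IsRightDescent x a) (hb : cs.IsRightDescent x b) :
    cs.IsRightDescent (x * cs.simple a) b ∧
    cs.IsRightDescent (x * cs.simple a * cs.simple b) a ∧
    cs.IsRightDescent (x * cs.simple a * cs.simple b * cs.simple a) b ∧
    cs.IsRightDescent (x * cs.simple a * cs.simple b * cs.simple a * cs.simple b) a ∧
    cs.IsRightDescent
      (x * cs.simple a * cs.simple b * cs.simple a * cs.simple b * cs.simple a) b := by
  have h := cs.length_mul_alternatingWord_inv hb ha hab
  simp only [alternatingWord, List.concat_eq_append, List.nil_append, List.cons_append,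
    wordProd_cons, wordProd_nil, mul_one, mul_inv_rev, inv_simple, ← mul_assoc] at h
  have h2 := cs.length_mul_simple (x * cs.simple a) b
  have h3 := cs.length_mul_simple (x * cs.simple a * cs.simple b) a
  have h4 := cs.length_mul_simple (x * cs.simple a * cs.simple b * cs.simple a) b
  have h5 := cs.length_mul_simple (x * cs.simple a * cs.simple b * cs.simple a * cs.simple b) a
  have h6 := cs.length_mul_simple
    (x * cs.simple a * cs.simple b * cs.simple a * cs.simple b * cs.simple a) b
  simp only [isRightDescent_iff] at *
  lia

/-- If `r`, `t` commute and `s`, `t` braid, an element `y` with descent `t` and a tail `s r s r`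
yields a shorter element `h` with descents `r` and `s` for which `h * r * s` again has descent `t`. -/
theorem isRightDescent_descend
    {r s t : B} (hrt : orderOf (cs.simple r * cs.simple t) = 2)
    (hst : orderOf (cs.simple s * cs.simple t) = 3) {y : W}
    (hr : cs.IsRightDescent y r) (ht : cs.IsRightDescent y t)
    (hs : cs.IsRightDescent (y * cs.simple r) s)
    (hr' : cs.IsRightDescent (y * cs.simple r * cs.simple s) r)
    (hs' : cs.IsRightDescent (y * cs.simple r * cs.simple s * cs.simple r) s) :
    ∃ h : W, cs.length h < cs.length y ∧ cs.IsRightDescent h r ∧ cs.IsRightDescent h s ∧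
      cs.IsRightDescent (h * cs.simple r * cs.simple s) t := by
  have htr : orderOf (cs.simple t * cs.simple r) = 2 := by
    rw [← orderOf_inv]
    simpa using hrt
  have hts : orderOf (cs.simple t * cs.simple s) = 3 := by
    rw [← orderOf_inv]
    simpa using hst
  have hcomm : cs.simple t * cs.simple r = cs.simple r * cs.simple t := by
    have h := pow_orderOf_eq_one (cs.simple r * cs.simple t)
    rw [hrt, pow_two, ← eq_inv_iff_mul_eq_one, mul_inv_rev, inv_simple, inv_simple] at h
    exact h.symm
  have h3t := cs.isRightDescent_mul_of_commute hrt hr ht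
  obtain ⟨h4t, hs4⟩ := cs.isRightDescent_mul_of_braid hst hs h3t
  have h5t := cs.isRightDescent_mul_of_commute hrt hr' h4t
  have h6t := (cs.isRightDescent_mul_of_braid hts h5t hs').2
  refine ⟨y * cs.simple r * cs.simple s * cs.simple t, ?_,
    cs.isRightDescent_mul_of_commute htr h4t hr', hs4, ?_⟩
  · simp only [isRightDescent_iff] at *
    lia
  · rwa [mul_assoc _ (cs.simple t) (cs.simple r), hcomm, ← mul_assoc]

/-- Infinite descent: `r` and `s` are not both descents of `p` when `p * r * s` has descent `t`. -/
theorem false_of_isRightDescent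
    {r s t : B} (hrt : orderOf (cs.simple r * cs.simple t) = 2)
    (hst : orderOf (cs.simple s * cs.simple t) = 3)
    (hrs : orderOf (cs.simple r * cs.simple s) = 0 ∨ 6 ≤ orderOf (cs.simple r * cs.simple s))
    {p : W} (hr : cs.IsRightDescent p r) (hs : cs.IsRightDescent p s)
    (ht : cs.IsRightDescent (p * cs.simple r * cs.simple s) t) : False := by
  induction hn : cs.length p using Nat.strong_induction_on generalizing p with
  | _ n ih =>
    obtain ⟨h1, h2, h3, h4, h5⟩ := cs.isRightDescent_mul_of_le_orderOf hrs hr hs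
    obtain ⟨q, hq, hqr, hqs, hqt⟩ := cs.isRightDescent_descend hrt hst h2 ht h3 h4 h5
    refine ih _ ?_ hqr hqs hqt rfl
    simp only [isRightDescent_iff] at *
    lia

end CoxeterSystem

/-- Lemma 3.4: there is no `w ∈ W` with `w = (w₁)(ts) = (w₂)(r)`. -/
theorem no_element_ts_and_r
{W : Type*} [Group W] {M : CoxeterMatrix (Fin 3)} (cs : CoxeterSystem M W)
    (r s t : W) (hr : r = cs.simple 0) (hs : s = cs.simple 1) (ht : t = cs.simple 2)
    (hrt : orderOf (r * t) = 2)
    (hst : orderOf (s * t) = 3)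
    (hsr : orderOf (s * r) = 0 ∨ 7 ≤ orderOf (s * r)) :
    ¬ ∃ w w1 w2 : W,
        w = w1 * t * s ∧ cs.length w = cs.length w1 + 2 ∧
        w = w2 * r ∧ cs.length w = cs.length w2 + 1 := by
  subst hr hs ht
  rintro ⟨w, w1, w2, hw, hlen, hw2, hlen2⟩
  have hrs : orderOf (cs.simple 0 * cs.simple 1) = orderOf (cs.simple 1 * cs.simple 0) := by
    rw [← orderOf_inv]
    simp
  have hws : w * cs.simple 1 = w1 * cs.simple 2 := by simp [hw]
  have hwr : cs.IsRightDescent w 0 := by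
    rw [CoxeterSystem.isRightDescent_iff, hlen2, hw2]
    simp
  have hle := cs.length_mul_simple w 1
  have hle1 := cs.length_mul_simple w1 2
  rw [← hws] at hle1
  have hs : cs.IsRightDescent w 1 := by
    rw [CoxeterSystem.isRightDescent_iff]
    lia
  have ht : cs.IsRightDescent (w * cs.simple 1) 2 := by
    rw [CoxeterSystem.isRightDescent_iff, hws, cs.simple_mul_simple_cancel_right, ← hws]
    lia
  obtain ⟨h1, h2, h3, h4, -⟩ :=
    cs.isRightDescent_mul_of_le_orderOf (hsr.imp id (by lia)) hs hwr
  obtain ⟨q, -, hqr, hqs, hqt⟩ := cs.isRightDescent_descend hrt hst h1 ht h2 h3 h4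
  exact cs.false_of_isRightDescent hrt hst (hrs ▸ hsr.imp id (by lia)) hqr hqs hqt
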